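/- arXiv:2411.08922 — 3 statements merged into one kernel-verified Lean document; each statement's English description precedes it below -/
import Mathlib

section
/- For every 0 < α < 1 and every t > 0, the Mittag-Leffler function satisfies 0 < E_{α,1}(−t) < 1. -/
/-- The Mittag-Leffler function `E_{α,β}(z) = ∑_{n=0}^∞ z^n / Γ(αn+β)` for real argument. -/
noncomputable def mittagLeffler (α β z : ℝ) : ℝ :=
  ∑' n : ℕ, z ^ n / Real.Gamma (α * n + β)

open Filter Topology Finset

/-- The polynomial `k ↦ (αk+1)(αk+2)⋯(αk+n)` is a nonnegative combination of the
binomial coefficients `k ↦ (k+j).choose j`. -/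
lemma exists_prod_eq_sum_choose {α : ℝ} (hα0 : 0 ≤ α) (hα1 : α ≤ 1) (n : ℕ) :
    ∃ c : ℕ → ℝ, (∀ j, 0 ≤ c j) ∧ ∀ k : ℕ,
      ∏ j ∈ range n, (α * k + 1 + j) = ∑ j ∈ range (n + 1), c j * ((k + j).choose j : ℝ) := by
  induction n with
  | zero => exact ⟨fun _ => 1, fun _ => zero_le_one, fun k => by simp⟩
  | succ n ih =>
    obtain ⟨c, hc, h⟩ := ih
    refine ⟨fun j => (if j ≤ n then (n + 1 - α * (j + 1)) * c j else 0) + α * j * c (j - 1),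
      fun j => ?_, fun k => ?_⟩
    · refine add_nonneg ?_ (mul_nonneg (by positivity) (hc _))
      split_ifs with hj
      · refine mul_nonneg ?_ (hc j)
        have hj' : (j : ℝ) ≤ n := by exact_mod_cast hj
        nlinarith
      · exact le_rfl
    · rw [prod_range_succ, h]
      simp only [add_mul _ _ (((k + _ : ℕ).choose _ : ℕ) : ℝ)]
      rw [sum_add_distrib, sum_range_succ _ (n + 1),
        sum_range_succ' (fun j => α * (j : ℝ) * _ * _), if_neg (by omega : ¬ n + 1 ≤ n)]
      simp only [Nat.cast_zero, mul_zero, zero_mul, add_zero, Nat.add_sub_cancel]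
      rw [← sum_add_distrib, sum_mul]
      refine sum_congr rfl fun j hj => ?_
      rw [if_pos (by simpa [Nat.lt_succ_iff] using hj)]
      have e : ((k : ℝ) + j + 1) * ((k + j).choose j : ℝ)
          = ((k + (j + 1)).choose (j + 1) : ℝ) * (j + 1) := by
        exact_mod_cast Nat.add_one_mul_choose_eq (k + j) j
      push_cast
      linear_combination α * c j * e

/-- The generating function of `k ↦ (αk+1)(αk+2)⋯(αk+n)` is nonnegative and monotone
on `(-1, 0]`. -/
lemma exists_hasSum_prod_mul_pow {α : ℝ} (hα0 : 0 ≤ α) (hα1 : α ≤ 1) (n : ℕ) :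
    ∃ F : ℝ → ℝ, (∀ r, |r| < 1 →
        HasSum (fun k : ℕ => (∏ j ∈ range n, (α * k + 1 + j)) * r ^ k) (F r)) ∧
      (∀ r < 1, 0 ≤ F r) ∧ ∀ r s, r ≤ s → s < 1 → F r ≤ F s := by
  obtain ⟨c, hc, h⟩ := exists_prod_eq_sum_choose hα0 hα1 n
  refine ⟨fun r => ∑ j ∈ range (n + 1), c j * (1 / (1 - r) ^ (j + 1)), fun r hr => ?_,
    fun r hr => ?_, fun r s hrs hs => ?_⟩
  · simp only [h, sum_mul]
    refine hasSum_sum fun j _ => ?_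
    simp only [mul_assoc]
    exact (hasSum_choose_mul_geometric_of_norm_lt_one j (by simpa using hr)).mul_left (c j)
  · have : 0 < 1 - r := by linarith
    exact sum_nonneg fun j _ => mul_nonneg (hc j) (by positivity)
  · have : 0 < 1 - s := by linarith
    refine sum_le_sum fun j _ => mul_le_mul_of_nonneg_left ?_ (hc j)
    gcongr

lemma Real.GammaSeq_pos {s : ℝ} (hs : 0 < s) {n : ℕ} (hn : n ≠ 0) : 0 < Real.GammaSeq s n := by
  have : 0 < (n : ℝ) := by positivity
  exact div_pos (by positivity) (prod_pos fun j _ => by positivity)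

lemma Real.GammaSeq_le_succ {s : ℝ} (hs : 1 ≤ s) {n : ℕ} (hn : n ≠ 0) :
    Real.GammaSeq s n ≤ Real.GammaSeq s (n + 1) := by
  have hn0 : 0 < (n : ℝ) := by positivity
  have hs0 : 0 < s := by linarith
  have hP : 0 < ∏ j ∈ range (n + 1), (s + j) := prod_pos fun j _ => by positivity
  have hb : 1 + s * (1 / n) ≤ (1 + 1 / (n : ℝ)) ^ s :=
    one_add_mul_self_le_rpow_one_add (by linarith [show 0 < 1 / (n : ℝ) by positivity]) hs
  have hpow : ((n + 1 : ℕ) : ℝ) ^ s = (n : ℝ) ^ s * (1 + 1 / (n : ℝ)) ^ s := by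
    rw [← Real.mul_rpow hn0.le (by positivity)]
    congr 1
    push_cast
    field_simp
  have hfac : s + ((n + 1 : ℕ) : ℝ) ≤ (1 + 1 / (n : ℝ)) ^ s * (n + 1) := by
    refine le_trans ?_ (mul_le_mul_of_nonneg_right hb (by positivity))
    have : (1 + s * (1 / n)) * ((n : ℝ) + 1) = n + 1 + s + s / n := by field_simp; ring
    rw [this]
    push_cast
    linarith [show 0 < s / n by positivity]
  unfold Real.GammaSeq
  rw [prod_range_succ _ (n + 1), hpow, Nat.factorial_succ, div_le_div_iff₀ hP (by positivity)]
  push_cast at hfac ⊢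
  have hA : 0 ≤ (n : ℝ) ^ s * (n.factorial : ℝ) * ∏ j ∈ range (n + 1), (s + j) := by positivity
  linarith [mul_le_mul_of_nonneg_left hfac hA]

lemma Real.GammaSeq_mono {s : ℝ} (hs : 1 ≤ s) {m n : ℕ} (hm : m ≠ 0) (hmn : m ≤ n) :
    Real.GammaSeq s m ≤ Real.GammaSeq s n := by
  induction n, hmn using Nat.le_induction with
  | base => exact le_rfl
  | succ n hmn ih => exact ih.trans (Real.GammaSeq_le_succ hs (by omega))

lemma pow_mul_inv_GammaSeq (α z : ℝ) {n : ℕ} (hn : n ≠ 0) (k : ℕ) :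
    z ^ k * (Real.GammaSeq (α * k + 1) n)⁻¹ = ((n : ℝ) * n.factorial)⁻¹ *
      ((∏ j ∈ range (n + 1), (α * k + 1 + j)) * (z / (n : ℝ) ^ α) ^ k) := by
  have hn0 : 0 < (n : ℝ) := by positivity
  rw [Real.GammaSeq, Real.rpow_add hn0, Real.rpow_one, Real.rpow_mul hn0.le, Real.rpow_natCast,
    div_pow, inv_div]
  field_simp

lemma eventually_abs_div_rpow_lt_one {α : ℝ} (hα0 : 0 < α) (z : ℝ) :
    ∀ᶠ n : ℕ in atTop, |z / (n : ℝ) ^ α| < 1 := by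
  have h : Tendsto (fun n : ℕ => z / (n : ℝ) ^ α) atTop (𝓝 0) :=
    ((tendsto_rpow_atTop hα0).comp tendsto_natCast_atTop_atTop).const_div_atTop z
  have := h.abs
  rw [abs_zero] at this
  exact this.eventually_lt_const one_pos

/-- Replacing `Γ` by Euler's finite products, the series converge absolutely and are eventually
dominated by a summable sequence. -/
lemma exists_summable_bound {α : ℝ} (hα0 : 0 < α) (hα1 : α ≤ 1) (z : ℝ) :
    ∃ B : ℕ → ℝ, Summable B ∧ ∀ᶠ n : ℕ in atTop, ∀ k : ℕ,
      ‖z ^ k * (Real.GammaSeq (α * k + 1) n)⁻¹‖ ≤ B k := by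
  obtain ⟨N, hN, hN0⟩ :=
    ((eventually_abs_div_rpow_lt_one hα0 |z|).and (eventually_ne_atTop 0)).exists
  obtain ⟨F, hF, -⟩ := exists_hasSum_prod_mul_pow hα0.le hα1 (N + 1)
  refine ⟨fun k => |z| ^ k * (Real.GammaSeq (α * k + 1) N)⁻¹, ?_, ?_⟩
  · simp only [pow_mul_inv_GammaSeq α |z| hN0]
    exact ((hF _ hN).summable).mul_left _
  · filter_upwards [eventually_ge_atTop N] with n hn k
    have hs : 1 ≤ α * k + 1 := by linarith [show 0 ≤ α * k by positivity]
    have hpos : 0 < Real.GammaSeq (α * k + 1) N := Real.GammaSeq_pos (by linarith) hN0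
    have hle := Real.GammaSeq_mono hs hN0 hn
    rw [norm_mul, norm_pow, Real.norm_eq_abs, norm_inv, Real.norm_eq_abs,
      abs_of_pos (hpos.trans_le hle)]
    gcongr

lemma tendsto_pow_mul_inv_GammaSeq {α : ℝ} (hα0 : 0 < α) (z : ℝ) (k : ℕ) :
    Tendsto (fun n => z ^ k * (Real.GammaSeq (α * k + 1) n)⁻¹) atTop
      (𝓝 (z ^ k / Real.Gamma (α * k + 1))) :=
  ((Real.GammaSeq_tendsto_Gamma _).inv₀
    (Real.Gamma_pos_of_pos (by positivity)).ne').const_mul _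

lemma tendsto_tsum_GammaSeq {α : ℝ} (hα0 : 0 < α) (hα1 : α ≤ 1) (z : ℝ) :
    Tendsto (fun n => ∑' k : ℕ, z ^ k * (Real.GammaSeq (α * k + 1) n)⁻¹) atTop
      (𝓝 (mittagLeffler α 1 z)) := by
  obtain ⟨B, hB, h⟩ := exists_summable_bound hα0 hα1 z
  exact tendsto_tsum_of_dominated_convergence hB (tendsto_pow_mul_inv_GammaSeq hα0 z) h

lemma summable_norm_mittagLeffler {α : ℝ} (hα0 : 0 < α) (hα1 : α ≤ 1) (z : ℝ) :
    Summable fun k : ℕ => ‖z ^ k / Real.Gamma (α * k + 1)‖ := by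
  obtain ⟨B, hB, h⟩ := exists_summable_bound hα0 hα1 z
  refine hB.of_nonneg_of_le (fun _ => norm_nonneg _) fun k => ?_
  exact le_of_tendsto (tendsto_pow_mul_inv_GammaSeq hα0 z k).norm (h.mono fun n hn => hn k)

lemma exists_tsum_GammaSeq_eq {α : ℝ} (hα0 : 0 < α) (hα1 : α ≤ 1) {n : ℕ} (hn : n ≠ 0) :
    ∃ F : ℝ → ℝ, (∀ z, |z / (n : ℝ) ^ α| < 1 →
        ∑' k : ℕ, z ^ k * (Real.GammaSeq (α * k + 1) n)⁻¹ = F z) ∧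
      (∀ z ≤ 0, 0 ≤ F z) ∧ ∀ z w, z ≤ w → w ≤ 0 → F z ≤ F w := by
  obtain ⟨F, hF, hF0, hFm⟩ := exists_hasSum_prod_mul_pow hα0.le hα1 (n + 1)
  have hn0 : 0 < (n : ℝ) ^ α := by positivity
  have hlt : ∀ z ≤ (0 : ℝ), z / (n : ℝ) ^ α < 1 := fun z hz =>
    (div_nonpos_of_nonpos_of_nonneg hz hn0.le).trans_lt one_pos
  refine ⟨fun z => ((n : ℝ) * n.factorial)⁻¹ * F (z / (n : ℝ) ^ α), fun z hz => ?_,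
    fun z hz => mul_nonneg (by positivity) (hF0 _ (hlt z hz)), fun z w hzw hw => ?_⟩
  · simp only [pow_mul_inv_GammaSeq α z hn]
    exact ((hF _ hz).mul_left _).tsum_eq
  · exact mul_le_mul_of_nonneg_left (hFm _ _ (by gcongr) (hlt w hw)) (by positivity)

lemma mittagLeffler_nonneg_of_nonpos {α : ℝ} (hα0 : 0 < α) (hα1 : α ≤ 1) {z : ℝ} (hz : z ≤ 0) :
    0 ≤ mittagLeffler α 1 z := by
  refine ge_of_tendsto (tendsto_tsum_GammaSeq hα0 hα1 z) ?_
  filter_upwards [eventually_abs_div_rpow_lt_one hα0 z, eventually_ne_atTop 0] with n hn hn0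
  obtain ⟨F, hF, hF0, -⟩ := exists_tsum_GammaSeq_eq hα0 hα1 hn0
  exact (hF z hn).symm ▸ hF0 z hz

lemma mittagLeffler_monotoneOn {α : ℝ} (hα0 : 0 < α) (hα1 : α ≤ 1) :
    MonotoneOn (mittagLeffler α 1) (Set.Iic 0) := by
  intro z _ w hw hzw
  refine le_of_tendsto_of_tendsto (tendsto_tsum_GammaSeq hα0 hα1 z)
    (tendsto_tsum_GammaSeq hα0 hα1 w) ?_
  filter_upwards [eventually_abs_div_rpow_lt_one hα0 z, eventually_abs_div_rpow_lt_one hα0 w,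
    eventually_ne_atTop 0] with n hz hw' hn0
  obtain ⟨F, hF, -, hFm⟩ := exists_tsum_GammaSeq_eq hα0 hα1 hn0
  simpa only [hF z hz, hF w hw'] using hFm z w hzw hw

lemma mittagLeffler_hasFPowerSeriesOnBall {α : ℝ} (hα0 : 0 < α) (hα1 : α ≤ 1) :
    HasFPowerSeriesOnBall (mittagLeffler α 1)
      (FormalMultilinearSeries.ofScalars ℝ fun k : ℕ => (Real.Gamma (α * k + 1))⁻¹) 0 ⊤ := by
  have hr : (FormalMultilinearSeries.ofScalars ℝ
      fun k : ℕ => (Real.Gamma (α * k + 1))⁻¹).radius = ⊤ := by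
    refine FormalMultilinearSeries.radius_eq_top_of_summable_norm _ fun r => ?_
    refine (summable_norm_mittagLeffler hα0 hα1 r).congr fun k => ?_
    rw [FormalMultilinearSeries.ofScalars_norm, div_eq_inv_mul, norm_mul, norm_pow,
      Real.norm_of_nonneg r.coe_nonneg]
  have h := FormalMultilinearSeries.hasFPowerSeriesOnBall _ (hr ▸ ENNReal.zero_lt_top)
  rw [hr] at h
  refine h.congr fun z _ => tsum_congr fun k => ?_
  simp [FormalMultilinearSeries.ofScalars, div_eq_inv_mul]

/-- `E_{α,1}` is not constant on any nonempty open interval. -/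
lemma not_mittagLeffler_eq_const {α : ℝ} (hα0 : 0 < α) (hα1 : α ≤ 1) {a b : ℝ} (hab : a < b)
    (c : ℝ) : ¬ ∀ z ∈ Set.Ioo a b, mittagLeffler α 1 z = c := by
  intro h
  have hps := mittagLeffler_hasFPowerSeriesOnBall hα0 hα1
  have han : AnalyticOnNhd ℝ (mittagLeffler α 1) Set.univ := by
    simpa using hps.analyticOnNhd
  obtain ⟨m, hm⟩ := exists_between hab
  have heq : mittagLeffler α 1 = fun _ => c :=
    han.eq_of_eventuallyEq analyticOnNhd_const
      (eventually_of_mem (Ioo_mem_nhds hm.1 hm.2) h : _ =ᶠ[𝓝 m] _)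
  have hd := hps.hasFPowerSeriesAt.deriv
  rw [heq, deriv_const] at hd
  have hΓ := Real.Gamma_pos_of_pos (show 0 < α + 1 by linarith)
  simp [FormalMultilinearSeries.ofScalars] at hd
  exact hΓ.ne hd

/-- For every `0 < α < 1` and every `t > 0`, one has `0 < E_{α,1}(−t) < 1`. -/
theorem mittagLeffler_neg_pos_lt_one (α : ℝ) (hα0 : 0 < α) (hα1 : α < 1)
    (t : ℝ) (ht : 0 < t) :
    0 < mittagLeffler α 1 (-t) ∧ mittagLeffler α 1 (-t) < 1 := by
  have hmono := mittagLeffler_monotoneOn hα0 hα1.le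
  have hzero : mittagLeffler α 1 0 = 1 := by
    unfold mittagLeffler
    rw [tsum_eq_single 0 fun k hk => by simp [hk]]
    simp
  have htm : -t ∈ Set.Iic (0 : ℝ) := by simpa using ht.le
  constructor
  · refine (mittagLeffler_nonneg_of_nonpos hα0 hα1.le htm).lt_of_ne fun h => ?_
    refine not_mittagLeffler_eq_const hα0 hα1.le (show -t - 1 < -t by linarith) 0 fun z hz => ?_
    have hz0 : z ≤ 0 := hz.2.le.trans htm
    exact le_antisymm (h ▸ hmono hz0 htm hz.2.le) (mittagLeffler_nonneg_of_nonpos hα0 hα1.le hz0)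
  · refine (hzero ▸ hmono htm (Set.mem_Iic.2 le_rfl) htm).lt_of_ne fun h => ?_
    refine not_mittagLeffler_eq_const hα0 hα1.le (show -t < 0 by linarith) 1 fun z hz => ?_
    exact le_antisymm ((hmono hz.2.le (Set.mem_Iic.2 le_rfl) hz.2.le).trans_eq hzero)
      (h.symm.trans_le (hmono htm hz.2.le hz.1.le))
end

section
/- For every 0 < α < 1, the function t ↦ E_{α,1}(−t) is completely monotonic on (0,∞); that is, for every n ∈ ℕ and every t > 0, (−1)^n (d^n/dt^n) E_{α,1}(−t) ≥ 0. -/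
open Filter Topology Finset

/-- The `N`-th Gauss product `∏_{i=1}^{N} (1 + x / i)`. -/
noncomputable def gaussProd (x : ℝ) (N : ℕ) : ℝ :=
  ∏ i ∈ range N, (1 + x / (i + 1))

lemma gaussProd_nonneg {x : ℝ} (hx : 0 ≤ x) (N : ℕ) : 0 ≤ gaussProd x N :=
  prod_nonneg fun i _ => by positivity

lemma gaussProd_succ (x : ℝ) (N : ℕ) :
    gaussProd x (N + 1) = gaussProd x N * (1 + x / (N + 1)) :=
  prod_range_succ _ _

/-- `x ↦ ∏_{i=1}^{N} (1 + α x / i)` has nonnegative coordinates in the binomial basis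
`x ↦ C(x + m, m)`. -/
lemma exists_gaussProd_eq_sum_choose {α : ℝ} (hα0 : 0 ≤ α) (hα1 : α ≤ 1) (N : ℕ) :
    ∃ c : ℕ → ℝ, (∀ m, 0 ≤ c m) ∧ (∀ m, N < m → c m = 0) ∧
      ∀ k : ℕ, gaussProd (α * k) N = ∑ m ∈ range (N + 1), c m * ((k + m).choose m : ℝ) := by
  induction N with
  | zero =>
    refine ⟨fun m => if m = 0 then 1 else 0, fun m => by dsimp only; split_ifs <;> norm_num,
      fun m hm => if_neg hm.ne', fun k => by simp [gaussProd]⟩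
  | succ N ih =>
    obtain ⟨c, hc0, hcN, hc⟩ := ih
    have hN : (0 : ℝ) < N + 1 := by positivity
    let u : ℕ → ℝ := fun m => m.casesOn 0 fun m => c m * (α * (m + 1) / (N + 1))
    have hu0 : u 0 = 0 := rfl
    have hu1 (m : ℕ) : u (m + 1) = c m * (α * (m + 1) / (N + 1)) := rfl
    let v : ℕ → ℝ := fun m => c m * (1 - α * (m + 1) / (N + 1))
    have hv : v (N + 1) = 0 := by simp [v, hcN]
    refine ⟨fun m => u m + v m, fun m => add_nonneg ?_ ?_, fun m hm => ?_, fun k => ?_⟩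
    · rcases m with _ | m
      · exact le_rfl
      · exact mul_nonneg (hc0 m) (by positivity)
    · by_cases hm : N < m
      · simp [v, hcN m hm]
      · refine mul_nonneg (hc0 m) (sub_nonneg.2 ((div_le_one hN).2 ?_))
        have : (m : ℝ) ≤ N := by exact_mod_cast not_lt.1 hm
        nlinarith
    · rcases m with _ | m
      · omega
      · simp [u, v, hcN m (by omega), hcN (m + 1) (by omega)]
    · rw [gaussProd_succ, hc, sum_mul]
      simp only [add_mul]
      rw [sum_add_distrib, sum_range_succ' (fun m => u m * ((k + m).choose m : ℝ)),
        sum_range_succ (fun m => v m * ((k + m).choose m : ℝ)), hv]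
      simp only [hu0, hu1, zero_mul, add_zero]
      rw [← sum_add_distrib]
      refine sum_congr rfl fun m _ => ?_
      have h : ((m : ℝ) + 1) * ((k + (m + 1)).choose (m + 1) : ℝ)
          = (k + m + 1) * ((k + m).choose m : ℝ) := by
        have := Nat.add_one_mul_choose_eq (k + m) m
        rw [← add_assoc]
        have h2 : ((k + m + 1 : ℕ) : ℝ) * ((k + m).choose m : ℝ)
          = ((k + m + 1).choose (m + 1) : ℝ) * ((m + 1 : ℕ) : ℝ) := by exact_mod_cast this
        push_cast at h2
        linarith
      simp only [v]
      field_simp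
      linear_combination (-c m * α) * h

lemma descFactorial_mul_choose (k m n : ℕ) :
    (k + n).descFactorial n * (k + n + m).choose m
      = (m + n).descFactorial n * (k + (m + n)).choose (m + n) := by
  have h1 := Nat.factorial_mul_descFactorial (Nat.le_add_left n k)
  have h2 := Nat.factorial_mul_descFactorial (Nat.le_add_left n m)
  have h3 := Nat.add_choose_mul_factorial_mul_factorial (k + n) m
  have h4 := Nat.add_choose_mul_factorial_mul_factorial k (m + n)
  rw [Nat.add_sub_cancel] at h1 h2
  have h7 : k + (m + n) = k + n + m := by ring
  rw [h7] at h4 ⊢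
  refine Nat.eq_of_mul_eq_mul_left
    (mul_pos k.factorial_pos m.factorial_pos) ?_
  rw [← h1] at h3
  rw [← h2] at h4
  linarith

/-- Differentiated binomial generating function of the Gauss products. -/
lemma exists_hasSum_gaussProd {α : ℝ} (hα0 : 0 ≤ α) (hα1 : α ≤ 1) (N n : ℕ) {r : ℝ}
    (hr : |r| < 1) :
    ∃ S : ℝ, 0 ≤ S ∧ HasSum (fun k : ℕ =>
      ((k + n).descFactorial n : ℝ) * gaussProd (α * (k + n : ℕ)) N * r ^ k) S := by
  obtain ⟨c, hc0, -, hc⟩ := exists_gaussProd_eq_sum_choose hα0 hα1 N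
  have hr1 : 0 < 1 - r := by linarith [(abs_lt.1 hr).2]
  refine ⟨∑ m ∈ range (N + 1), c m * ((m + n).descFactorial n : ℝ)
    * (1 / (1 - r) ^ (m + n + 1)), sum_nonneg fun m _ => ?_, ?_⟩
  · have := hc0 m
    positivity
  · have h := hasSum_sum (s := range (N + 1)) fun m _ =>
      (hasSum_choose_mul_geometric_of_norm_lt_one (m + n) (r := r) hr).mul_left
        (c m * ((m + n).descFactorial n : ℝ))
    refine h.congr_fun fun k => ?_
    rw [hc, mul_sum, sum_mul]
    refine sum_congr rfl fun m _ => ?_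
    have h1 : ((k + n).descFactorial n : ℝ) * ((k + n + m).choose m : ℝ)
      = ((m + n).descFactorial n : ℝ) * ((k + (m + n)).choose (m + n) : ℝ) := by
      exact_mod_cast descFactorial_mul_choose k m n
    linear_combination (c m * r ^ k) * h1

lemma tendsto_gaussProd_div_rpow {x : ℝ} (hx : 0 ≤ x) :
    Tendsto (fun N : ℕ => gaussProd x N / (N : ℝ) ^ x) atTop (𝓝 (Real.Gamma (x + 1))⁻¹) := by
  have hprod (N : ℕ) : gaussProd x N * N.factorial = ∏ j ∈ range N, (x + 1 + j) := by
    induction N with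
    | zero => simp [gaussProd]
    | succ N ih =>
      rw [gaussProd_succ, prod_range_succ, ← ih, Nat.factorial_succ]
      have : (0 : ℝ) < N + 1 := by positivity
      push_cast
      field_simp
      ring
  have h1 : Tendsto (fun N : ℕ => (x + 1 + N) / (N : ℝ)) atTop (𝓝 1) := by
    have := (tendsto_const_div_atTop_nhds_zero_nat (x + 1)).add_const 1
    rw [zero_add] at this
    refine this.congr' ?_
    filter_upwards [eventually_ne_atTop 0] with N hN
    field_simp
  have h2 := (h1.mul (Real.GammaSeq_tendsto_Gamma (x + 1))).inv₀
    (by rw [one_mul]; exact (Real.Gamma_pos_of_pos (by linarith)).ne')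
  rw [one_mul] at h2
  refine h2.congr' ?_
  filter_upwards [eventually_ne_atTop 0] with N hN
  have hN0 : (0 : ℝ) < N := by positivity
  have hNx : (0 : ℝ) < (N : ℝ) ^ x := Real.rpow_pos_of_pos hN0 x
  have hf : (0 : ℝ) < N.factorial := by positivity
  have hg : 0 < gaussProd x N := prod_pos fun i _ => by positivity
  have hxN : 0 < x + 1 + N := by positivity
  rw [Real.GammaSeq, prod_range_succ, ← hprod, Real.rpow_add_one hN0.ne']
  field_simp

lemma gaussProd_div_rpow_antitone {x : ℝ} (hx : 0 ≤ x) {M N : ℕ} (hM : 0 < M) (hMN : M ≤ N) :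
    gaussProd x N / (N : ℝ) ^ x ≤ gaussProd x M / (M : ℝ) ^ x := by
  induction N, hMN using Nat.le_induction with
  | base => exact le_rfl
  | succ N hN ih =>
    refine le_trans ?_ ih
    have hN0 : (0 : ℝ) < N := by exact_mod_cast hM.trans_le hN
    have hg := gaussProd_nonneg hx N
    rw [gaussProd_succ, div_le_div_iff₀ (by positivity) (by positivity), mul_assoc]
    refine mul_le_mul_of_nonneg_left ?_ hg
    push_cast
    have h1 : (N : ℝ) ≤ (N + 1) * Real.exp (-(1 / (N + 1))) := by
      have := Real.add_one_le_exp (-(1 / ((N : ℝ) + 1)))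
      calc (N : ℝ) = (N + 1) * (-(1 / (N + 1)) + 1) := by field_simp; ring
        _ ≤ _ := by gcongr
    calc (1 + x / (N + 1)) * (N : ℝ) ^ x
        ≤ Real.exp (x / (N + 1)) * ((N + 1) * Real.exp (-(1 / (N + 1)))) ^ x := by
          gcongr
          linarith [Real.add_one_le_exp (x / ((N : ℝ) + 1))]
      _ = ((N : ℝ) + 1) ^ x := by
          rw [Real.mul_rpow (by positivity) (by positivity), ← Real.exp_mul, mul_left_comm,
            ← Real.exp_add]
          have : x / ((N : ℝ) + 1) + -(1 / (N + 1)) * x = 0 := by ring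
          rw [this, Real.exp_zero, mul_one]

lemma summable_derivative_coeff {a : ℕ → ℝ} (ha : ∀ r : ℝ, Summable fun k => a k * r ^ k)
    (r : ℝ) : Summable fun k : ℕ => a (k + 1) * (k + 1) * r ^ k := by
  refine Summable.of_norm_bounded
    ((summable_nat_add_iff 1).2 (ha (2 * (|r| + 1))).abs) fun k => ?_
  have h1 : ((k : ℝ) + 1) ≤ 2 ^ (k + 1) := by
    exact_mod_cast (Nat.lt_two_pow_self (n := k + 1)).le
  have h2 : |r| ^ k ≤ (|r| + 1) ^ (k + 1) :=
    (pow_le_pow_left₀ (abs_nonneg r) (by linarith) k).trans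
      (pow_le_pow_right₀ (by linarith [abs_nonneg r]) k.le_succ)
  have h3 : |(k : ℝ) + 1| = k + 1 := abs_of_pos (by positivity)
  have h4 : |2 * (|r| + 1)| = 2 * (|r| + 1) := abs_of_pos (by positivity)
  rw [Real.norm_eq_abs, abs_mul, abs_mul, abs_mul, abs_pow, abs_pow, h3, h4, mul_pow, mul_assoc]
  gcongr

lemma hasDerivAt_tsum_pow {a : ℕ → ℝ} (ha : ∀ r : ℝ, Summable fun k => a k * r ^ k) (x : ℝ) :
    HasDerivAt (fun y => ∑' k, a k * y ^ k) (∑' k : ℕ, a (k + 1) * (k + 1) * x ^ k) x := by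
  have hu : Summable fun k : ℕ => ‖a k * (k * (|x| + 1) ^ (k - 1))‖ := by
    refine (summable_nat_add_iff 1).1 ?_
    refine (summable_derivative_coeff ha (|x| + 1)).norm.congr fun k => ?_
    simp [mul_assoc]
  have hx : x ∈ Metric.ball (0 : ℝ) (|x| + 1) := by simp
  have h := hasDerivAt_tsum_of_isPreconnected (g := fun k y => a k * y ^ k)
    (g' := fun k y => a k * (k * y ^ (k - 1))) hu Metric.isOpen_ball
    (convex_ball (0 : ℝ) (|x| + 1)).isPreconnected
    (fun k y _ => (hasDerivAt_pow k y).const_mul (a k)) (fun k y hy => ?_) hx (ha x) hx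
  · have hs : Summable fun k : ℕ => a k * (k * x ^ (k - 1)) := by
      refine (summable_nat_add_iff 1).1 ?_
      refine (summable_derivative_coeff ha x).congr fun k => ?_
      simp [mul_assoc]
    rw [hs.tsum_eq_zero_add] at h
    simpa [mul_assoc] using h
  · have hy' : |y| ≤ |x| + 1 := by simpa using (mem_ball_zero_iff.1 hy).le
    rw [norm_mul, norm_mul, norm_mul, norm_mul, norm_pow, norm_pow]
    have : ‖y‖ ≤ ‖|x| + 1‖ := by
      rw [Real.norm_eq_abs, Real.norm_of_nonneg (by positivity)]
      exact hy'
    gcongr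

lemma iteratedDeriv_tsum_pow {a : ℕ → ℝ} (ha : ∀ r : ℝ, Summable fun k => a k * r ^ k)
    (n : ℕ) (x : ℝ) :
    iteratedDeriv n (fun y => ∑' k, a k * y ^ k) x
      = ∑' k : ℕ, ((k + n).descFactorial n : ℝ) * a (k + n) * x ^ k := by
  induction n generalizing a with
  | zero => simp
  | succ n ih =>
    have hd : deriv (fun y => ∑' k, a k * y ^ k)
        = fun y => ∑' k : ℕ, a (k + 1) * (k + 1) * y ^ k :=
      funext fun y => (hasDerivAt_tsum_pow ha y).deriv
    rw [iteratedDeriv_succ', hd, ih (summable_derivative_coeff ha)]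
    refine tsum_congr fun k => ?_
    rw [← add_assoc, Nat.succ_descFactorial_succ]
    push_cast
    ring

/-- The Gauss products dominate the reciprocal Gamma function. -/
lemma inv_Gamma_le_gaussProd_div_rpow {x : ℝ} (hx : 0 ≤ x) {M : ℕ} (hM : 0 < M) :
    (Real.Gamma (x + 1))⁻¹ ≤ gaussProd x M / (M : ℝ) ^ x :=
  le_of_tendsto (tendsto_gaussProd_div_rpow hx) <| by
    filter_upwards [eventually_ge_atTop M] with N hN
    exact gaussProd_div_rpow_antitone hx hM hN

lemma exists_nat_lt_rpow {α : ℝ} (hα : 0 < α) (r : ℝ) :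
    ∃ M : ℕ, 0 < M ∧ ∀ N : ℕ, M ≤ N → r < (N : ℝ) ^ α := by
  obtain ⟨M, hM⟩ := eventually_atTop.1 <|
    ((tendsto_rpow_atTop hα).comp tendsto_natCast_atTop_atTop).eventually_gt_atTop r
  exact ⟨M + 1, M.succ_pos, fun N hN => hM N (by omega)⟩

/-- The differentiated series of the normalized Gauss products at `r`. -/
lemma exists_hasSum_gaussProd_div_rpow {α : ℝ} (hα0 : 0 ≤ α) (hα1 : α ≤ 1) (n : ℕ) {N : ℕ}
    (hN : 0 < N) {r : ℝ} (hr : |r| < (N : ℝ) ^ α) :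
    ∃ S : ℝ, 0 ≤ S ∧ HasSum (fun k : ℕ => ((k + n).descFactorial n : ℝ) *
      (gaussProd (α * (k + n : ℕ)) N / (N : ℝ) ^ (α * (k + n : ℕ))) * r ^ k) S := by
  have hN0 : (0 : ℝ) < N := by exact_mod_cast hN
  have hNα : (0 : ℝ) < (N : ℝ) ^ α := Real.rpow_pos_of_pos hN0 α
  obtain ⟨S, hS0, hS⟩ := exists_hasSum_gaussProd hα0 hα1 N n (r := r / (N : ℝ) ^ α)
    (by rwa [abs_div, abs_of_pos hNα, div_lt_one hNα])
  refine ⟨S * (((N : ℝ) ^ α) ^ n)⁻¹, by positivity, ?_⟩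
  refine (hS.mul_right (((N : ℝ) ^ α) ^ n)⁻¹).congr_fun fun k => ?_
  rw [Real.rpow_mul hN0.le, Real.rpow_natCast, div_pow, pow_add]
  field_simp

lemma summable_mittagLeffler {α : ℝ} (hα0 : 0 < α) (hα1 : α ≤ 1) (r : ℝ) :
    Summable fun k : ℕ => (Real.Gamma (α * k + 1))⁻¹ * r ^ k := by
  obtain ⟨M, hM, hMr⟩ := exists_nat_lt_rpow hα0 |r|
  obtain ⟨S, -, hS⟩ := exists_hasSum_gaussProd_div_rpow hα0.le hα1 0 hM (r := |r|)
    (by simpa using hMr M le_rfl)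
  refine Summable.of_norm_bounded hS.summable fun k => ?_
  have hG : 0 ≤ (Real.Gamma (α * k + 1))⁻¹ :=
    inv_nonneg.2 (Real.Gamma_pos_of_pos (by positivity)).le
  rw [norm_mul, norm_pow, Real.norm_of_nonneg hG, Real.norm_eq_abs]
  have := inv_Gamma_le_gaussProd_div_rpow (x := α * k) (by positivity) hM
  simp only [Nat.descFactorial_zero, Nat.cast_one, one_mul, add_zero]
  gcongr

/-- All derivatives of `E_{α,1}`, written as power series, are nonnegative on `(-∞, 0]`. -/
lemma tsum_descFactorial_div_Gamma_nonneg {α : ℝ} (hα0 : 0 < α) (hα1 : α ≤ 1) (n : ℕ) (t : ℝ) :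
    0 ≤ ∑' k : ℕ, ((k + n).descFactorial n : ℝ) *
      (Real.Gamma (α * (k + n : ℕ) + 1))⁻¹ * (-t) ^ k := by
  obtain ⟨M, hM, hMt⟩ := exists_nat_lt_rpow hα0 |t|
  obtain ⟨S, -, hS⟩ := exists_hasSum_gaussProd_div_rpow hα0.le hα1 n hM (r := |t|)
    (by simpa using hMt M le_rfl)
  have hx (k : ℕ) : 0 ≤ α * (k + n : ℕ) := by positivity
  refine ge_of_tendsto (tendsto_tsum_of_dominated_convergence hS.summable
    (fun k => ((tendsto_gaussProd_div_rpow (hx k)).const_mul _).mul_const _) ?_) ?_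
  · filter_upwards [eventually_ge_atTop M] with N hN k
    have h0 := gaussProd_nonneg (hx k) N
    have h1 := gaussProd_div_rpow_antitone (hx k) hM hN
    rw [norm_mul, norm_mul, norm_pow, norm_neg, Real.norm_eq_abs t, Real.norm_natCast,
      Real.norm_of_nonneg (by positivity)]
    gcongr
  · filter_upwards [eventually_ge_atTop M] with N hN
    obtain ⟨S, hS0, hS⟩ := exists_hasSum_gaussProd_div_rpow hα0.le hα1 n (hM.trans_le hN)
      (r := -t) (by simpa using hMt N hN)
    rwa [hS.tsum_eq]


/-- For every `0 < α < 1`, the function `t ↦ E_{α,1}(−t)` is completely monotonic on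
`(0,∞)`: for every `n ∈ ℕ` and every `t > 0`, `(−1)^n (d^n/dt^n) E_{α,1}(−t) ≥ 0`. -/
theorem mittagLeffler_completely_monotonic (α : ℝ) (hα0 : 0 < α) (hα1 : α < 1)
    (n : ℕ) (t : ℝ) (ht : 0 < t) :
    0 ≤ (-1 : ℝ) ^ n * iteratedDeriv n (fun s : ℝ => mittagLeffler α 1 (-s)) t := by
  have ha (r : ℝ) : Summable fun k : ℕ => (-1) ^ k * (Real.Gamma (α * k + 1))⁻¹ * r ^ k :=
    (summable_mittagLeffler hα0 hα1.le (-r)).congr fun k => by rw [neg_pow]; ring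
  have hf : (fun s : ℝ => mittagLeffler α 1 (-s))
      = fun s => ∑' k : ℕ, (-1) ^ k * (Real.Gamma (α * k + 1))⁻¹ * s ^ k := by
    funext s
    refine tsum_congr fun k => ?_
    rw [neg_pow]
    ring
  rw [hf, iteratedDeriv_tsum_pow ha, ← tsum_mul_left]
  refine (tsum_descFactorial_div_Gamma_nonneg hα0 hα1.le n t).trans_eq (tsum_congr fun k => ?_)
  have h : ((-1 : ℝ) ^ n) * (-1) ^ n = 1 := by rw [← mul_pow]; simp
  rw [neg_pow t, pow_add]
  linear_combination (-((k + n).descFactorial n : ℝ) *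
    (Real.Gamma (α * (k + n : ℕ) + 1))⁻¹ * (-1) ^ k * t ^ k) * h
end

section
/- For every 0 < α < 1 and every η > 0, the Mittag-Leffler function satisfies 0 ≤ E_{α,α}(−η) ≤ 1/Γ(α); moreover, the function η ↦ E_{α,α}(−η) is monotonically decreasing on (0,∞). -/
open Real Set MeasureTheory intervalIntegral Filter Topology

/-- The reciprocal Gamma function decays faster than any geometric rate on `(0,∞)`. -/
lemma exists_inv_Gamma_le_mul_rpow {q : ℝ} (hq : 0 < q) :
    ∃ C : ℝ, 0 < C ∧ ∀ s : ℝ, 0 < s → (Gamma s)⁻¹ ≤ C * q ^ s := by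
  set R : ℝ := exp 1 / q with hR
  have hR0 : 0 < R := by positivity
  refine ⟨exp R, exp_pos _, fun s hs => ?_⟩
  have h1 : R ^ s * exp (-R) ≤ Gamma (s + 1) := by
    rw [Gamma_eq_integral (by linarith), ← integral_exp_neg_Ioi R,
      ← MeasureTheory.integral_const_mul]
    have hint := GammaIntegral_convergent (show 0 < s + 1 by linarith)
    calc ∫ x in Ioi R, R ^ s * exp (-x)
        ≤ ∫ x in Ioi R, exp (-x) * x ^ (s + 1 - 1) := by
          refine setIntegral_mono_on ?_ (hint.mono_set (Ioi_subset_Ioi hR0.le))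
            measurableSet_Ioi fun x hx => ?_
          · exact (integrableOn_exp_neg_Ioi R).const_mul _
          · rw [mul_comm, add_sub_cancel_right]
            have hx' : R < x := hx
            gcongr
      _ ≤ ∫ x in Ioi 0, exp (-x) * x ^ (s + 1 - 1) := by
          refine setIntegral_mono_set hint ?_ (Ioi_subset_Ioi hR0.le).eventuallyLE
          filter_upwards [ae_restrict_mem measurableSet_Ioi] with x hx
          have hx' : (0 : ℝ) < x := hx
          simp only [Pi.zero_apply]
          positivity
  rw [Gamma_add_one hs.ne'] at h1
  have hG := Gamma_pos_of_pos hs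
  have h2 : s ≤ exp s := by linarith [add_one_le_exp s]
  have h3 : R ^ s * q ^ s = exp s := by
    rw [← mul_rpow hR0.le hq.le, hR, div_mul_cancel₀ _ hq.ne', exp_one_rpow]
  have h4 : exp R * exp (-R) = 1 := by rw [← exp_add]; simp
  rw [inv_le_iff_one_le_mul₀ hG]
  have hqs : 0 < q ^ s := by positivity
  have h5 : s * 1 ≤ s * (exp R * q ^ s * Gamma s) := by
    calc s * 1 ≤ R ^ s * q ^ s * (exp R * exp (-R)) := by rw [h3, h4]; linarith
      _ = exp R * q ^ s * (R ^ s * exp (-R)) := by ring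
      _ ≤ exp R * q ^ s * (s * Gamma s) := by gcongr
      _ = _ := by ring
  exact le_of_mul_le_mul_left h5 hs

/-- Euler's Beta integral on `[0, t]`. -/
lemma integral_rpow_mul_sub_rpow {u v t : ℝ} (hu : 0 < u) (hv : 0 < v) (ht : 0 < t) :
    ∫ s in (0 : ℝ)..t, s ^ (u - 1) * (t - s) ^ (v - 1) =
      t ^ (u + v - 1) * (Gamma u * Gamma v / Gamma (u + v)) := by
  have h := Complex.betaIntegral_scaled (u : ℂ) (v : ℂ) ht
  rw [Complex.betaIntegral_eq_Gamma_mul_div _ _ (by simpa) (by simpa)] at h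
  have h2 : ∫ x in (0 : ℝ)..t, (x : ℂ) ^ ((u : ℂ) - 1) * ((t : ℂ) - x) ^ ((v : ℂ) - 1) =
      ∫ x in (0 : ℝ)..t, ((x ^ (u - 1) * (t - x) ^ (v - 1) : ℝ) : ℂ) := by
    refine integral_congr fun x hx => ?_
    rw [uIcc_of_le ht.le] at hx
    have : 0 ≤ t - x := by linarith [hx.2]
    push_cast [Complex.ofReal_cpow hx.1, Complex.ofReal_cpow this]
    rfl
  rw [h2, intervalIntegral.integral_ofReal, ← Complex.ofReal_add, Complex.Gamma_ofReal,
    Complex.Gamma_ofReal, Complex.Gamma_ofReal] at h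
  have h3 : (t : ℂ) ^ (((u + v : ℝ) : ℂ) - 1) = ((t ^ (u + v - 1) : ℝ) : ℂ) := by
    rw [Complex.ofReal_cpow ht.le]; push_cast; rfl
  rw [h3] at h
  exact_mod_cast h

lemma intervalIntegrable_rpow_mul_sub_rpow {u v t : ℝ} (hu : 0 < u) (hv : 0 < v) (ht : 0 < t) :
    IntervalIntegrable (fun s : ℝ => s ^ (u - 1) * (t - s) ^ (v - 1)) volume 0 t := by
  by_contra h
  have h1 := integral_rpow_mul_sub_rpow hu hv ht
  rw [integral_undef h] at h1
  have := Gamma_pos_of_pos hu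
  have := Gamma_pos_of_pos hv
  have := Gamma_pos_of_pos (add_pos hu hv)
  have : 0 < t ^ (u + v - 1) * (Gamma u * Gamma v / Gamma (u + v)) := by positivity
  linarith

/-- Geometrically growing coefficients are summable against `1 / Γ(αn + β)`. -/
lemma summable_pow_div_Gamma {α β : ℝ} (hα : 0 < α) (hβ : 0 < β) {r : ℝ} (hr : 0 ≤ r) :
    Summable fun n : ℕ => r ^ n / Gamma (α * n + β) := by
  set ρ : ℝ := 1 / (1 + r) with hρ
  have hρ0 : 0 < ρ := by positivity
  obtain ⟨C, hC, hG⟩ := exists_inv_Gamma_le_mul_rpow (q := ρ ^ (1 / α)) (by positivity)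
  have hs : Summable fun n : ℕ => C * (ρ ^ (1 / α)) ^ β * (r * ρ) ^ n := by
    refine (summable_geometric_of_lt_one (by positivity) ?_).mul_left _
    rw [hρ, mul_one_div, div_lt_one (by positivity)]; linarith
  refine Summable.of_nonneg_of_le (fun n => ?_) (fun n => ?_) hs
  · have := Gamma_pos_of_pos (show 0 < α * n + β by positivity)
    positivity
  · have h := hG (α * n + β) (by positivity)
    rw [rpow_add (by positivity), rpow_mul (by positivity), ← rpow_mul hρ0.le,
      one_div_mul_cancel hα.ne', rpow_one, rpow_natCast] at h
    calc r ^ n / Gamma (α * n + β) = r ^ n * (Gamma (α * n + β))⁻¹ := div_eq_mul_inv _ _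
      _ ≤ r ^ n * (C * (ρ ^ n * (ρ ^ (1 / α)) ^ β)) := by gcongr
      _ = _ := by rw [mul_pow]; ring

lemma summable_mittagLeffler_s4 {α β : ℝ} (hα : 0 < α) (hβ : 0 < β) (z : ℝ) :
    Summable fun n : ℕ => z ^ n / Gamma (α * n + β) := by
  refine Summable.of_norm ((summable_pow_div_Gamma hα hβ (abs_nonneg z)).congr fun n => ?_)
  have := Gamma_pos_of_pos (show 0 < α * n + β by positivity)
  rw [norm_div, norm_pow, norm_eq_abs, norm_eq_abs, abs_of_pos this]

lemma continuous_mittagLeffler {α β : ℝ} (hα : 0 < α) (hβ : 0 < β) :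
    Continuous (mittagLeffler α β) := by
  rw [continuous_iff_continuousAt]
  intro x
  have hc : ContinuousOn (mittagLeffler α β) (Metric.ball 0 (|x| + 1)) := by
    refine continuousOn_tsum (fun n => by fun_prop)
      (summable_pow_div_Gamma hα hβ (r := |x| + 1) (by positivity)) fun n y hy => ?_
    have hG := Gamma_pos_of_pos (show 0 < α * n + β by positivity)
    rw [norm_div, norm_pow, norm_eq_abs (Gamma _), abs_of_pos hG]
    rw [mem_ball_zero_iff] at hy
    gcongr
  exact hc.continuousAt (Metric.isOpen_ball.mem_nhds (by simp))

lemma mittagLeffler_zero (α β : ℝ) : mittagLeffler α β 0 = 1 / Gamma β := by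
  rw [mittagLeffler, tsum_eq_single 0]
  · simp
  · intro n hn; simp [hn]

/-- Summation by antidiagonals of a double series whose kernel depends on the index sum only. -/
lemma sub_mul_tsum_pow_mul_pow {a b : ℝ} {d : ℕ → ℝ}
    (h : Summable fun p : ℕ × ℕ => a ^ p.1 * b ^ p.2 * d (p.1 + p.2 + 1))
    (ha : Summable fun n => a ^ n * d n) (hb : Summable fun n => b ^ n * d n) :
    (a - b) * ∑' p : ℕ × ℕ, a ^ p.1 * b ^ p.2 * d (p.1 + p.2 + 1) =
      ∑' n, a ^ n * d n - ∑' n, b ^ n * d n := by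
  have h1 := (Equiv.hasSum_iff Finset.HasAntidiagonal.sigmaAntidiagonalEquivProd).2 h.hasSum
  have h2 := (h1.sigma fun n => hasSum_fintype _).mul_left (a - b)
  rw [← ha.tsum_sub hb, (ha.sub hb).tsum_eq_zero_add]
  simp only [pow_zero, sub_self, zero_add]
  refine (h2.tsum_eq).symm.trans (tsum_congr fun n => ?_)
  simp only [Function.comp_apply, Finset.HasAntidiagonal.sigmaAntidiagonalEquivProd_apply]
  rw [Finset.sum_coe_sort (Finset.HasAntidiagonal.antidiagonal n)
    (fun p : ℕ × ℕ => a ^ p.1 * b ^ p.2 * d (p.1 + p.2 + 1)),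
    Finset.sum_congr rfl (fun p hp => by rw [Finset.HasAntidiagonal.mem_antidiagonal.1 hp]),
    ← Finset.sum_mul, Finset.Nat.sum_antidiagonal_eq_sum_range_succ (fun i j => a ^ i * b ^ j)]
  have := (Commute.all a b).geom_sum₂_mul (n + 1)
  simp only [Nat.add_sub_cancel] at this
  rw [← mul_assoc, mul_comm (a - b), this]; ring

/-- Resolvent identity for the kernels `s ^ (α - 1) * E_{α,α}(a s ^ α)`. -/
lemma resolvent_identity {α : ℝ} (hα : 0 < α) (a b : ℝ) {t : ℝ} (ht : 0 < t) :
    (a - b) * ∫ s in (0 : ℝ)..t, s ^ (α - 1) * (t - s) ^ (α - 1) *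
        (mittagLeffler α α (a * s ^ α) * mittagLeffler α α (b * (t - s) ^ α)) =
      t ^ (α - 1) * mittagLeffler α α (a * t ^ α) -
        t ^ (α - 1) * mittagLeffler α α (b * t ^ α) := by
  have hΓ : ∀ n : ℕ, 0 < Gamma (α * n + α) := fun n => Gamma_pos_of_pos (by positivity)
  have key : ∀ (c : ℝ) (n : ℕ) {s : ℝ}, 0 < s →
      s ^ (α - 1) * ((c * s ^ α) ^ n / Gamma (α * n + α)) =
        c ^ n / Gamma (α * n + α) * s ^ (α * n + α - 1) := by
    intro c n s hs
    rw [mul_pow, add_sub_assoc, rpow_add hs, rpow_mul hs.le, rpow_natCast]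
    ring
  set d : ℕ → ℝ := fun n => t ^ (α * n + α - 1) / Gamma (α * n + α) with hd
  set F : ℕ × ℕ → ℝ → ℝ := fun p s =>
    a ^ p.1 / Gamma (α * p.1 + α) * (b ^ p.2 / Gamma (α * p.2 + α)) *
      (s ^ (α * p.1 + α - 1) * (t - s) ^ (α * p.2 + α - 1)) with hF
  have hbeta : ∀ p : ℕ × ℕ, ∫ s in (0 : ℝ)..t,
      s ^ (α * p.1 + α - 1) * (t - s) ^ (α * p.2 + α - 1) =
        Gamma (α * p.1 + α) * Gamma (α * p.2 + α) * d (p.1 + p.2 + 1) := by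
    intro p
    rw [integral_rpow_mul_sub_rpow (by positivity) (by positivity) ht, hd]
    have : α * p.1 + α + (α * p.2 + α) = α * ((p.1 + p.2 + 1 : ℕ) : ℝ) + α := by
      push_cast; ring
    simp only [this]
    ring
  have hFint : ∀ p, IntervalIntegrable (F p) volume 0 t := fun p =>
    (intervalIntegrable_rpow_mul_sub_rpow (by positivity) (by positivity) ht).const_mul _
  have hFval : ∀ p, ∫ s in (0 : ℝ)..t, F p s = a ^ p.1 * b ^ p.2 * d (p.1 + p.2 + 1) := by
    intro p
    rw [hF]
    simp only
    rw [intervalIntegral.integral_const_mul, hbeta]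
    have := (hΓ p.1).ne'
    have := (hΓ p.2).ne'
    field_simp
  have hFnorm : ∀ p, ∫ s in (0 : ℝ)..t, ‖F p s‖ =
      |a| ^ p.1 * |b| ^ p.2 * d (p.1 + p.2 + 1) := by
    intro p
    have : ∀ s ∈ uIcc 0 t, ‖F p s‖ = |a| ^ p.1 / Gamma (α * p.1 + α) *
        (|b| ^ p.2 / Gamma (α * p.2 + α)) *
          (s ^ (α * p.1 + α - 1) * (t - s) ^ (α * p.2 + α - 1)) := by
      intro s hs
      rw [uIcc_of_le ht.le] at hs
      have h0 : 0 ≤ t - s := by linarith [hs.2]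
      simp only [hF, norm_eq_abs, abs_mul, abs_div, abs_pow, abs_of_pos (hΓ _),
        abs_of_nonneg (rpow_nonneg hs.1 _), abs_of_nonneg (rpow_nonneg h0 _)]
    rw [integral_congr this, intervalIntegral.integral_const_mul, hbeta]
    have := (hΓ p.1).ne'
    have := (hΓ p.2).ne'
    field_simp
  have hsum : Summable fun p : ℕ × ℕ => |a| ^ p.1 * |b| ^ p.2 * d (p.1 + p.2 + 1) := by
    set ρ : ℝ := 1 / (1 + |a| + |b|) with hρ
    have hρ0 : 0 < ρ := by positivity
    obtain ⟨C, hC, hG⟩ := exists_inv_Gamma_le_mul_rpow (q := ρ ^ (1 / α) / t) (by positivity)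
    have hgeo : ∀ c : ℝ, 0 ≤ c → c < 1 + |a| + |b| → Summable fun n : ℕ => (c * ρ) ^ n := by
      intro c hc hc'
      refine summable_geometric_of_lt_one (by positivity) ?_
      rw [hρ, mul_one_div, div_lt_one (by positivity)]; exact hc'
    have hprod := (((hgeo |a| (by positivity) (by linarith [abs_nonneg b])).mul_of_nonneg
      (hgeo |b| (by positivity) (by linarith [abs_nonneg a])) (fun n => by positivity)
      (fun n => by positivity))).mul_left (C * ρ ^ 2 / t)
    refine Summable.of_nonneg_of_le (fun p => ?_) (fun p => ?_) hprod
    · have := hΓ (p.1 + p.2 + 1)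
      simp only [hd]
      positivity
    · have h := hG (α * ((p.1 + p.2 + 1 : ℕ) : ℝ) + α) (by positivity)
      have e : α * ((p.1 + p.2 + 1 : ℕ) : ℝ) + α = α * ((p.1 + p.2 + 2 : ℕ) : ℝ) := by
        push_cast; ring
      have hq : (ρ ^ (1 / α) / t) ^ (α * ((p.1 + p.2 + 2 : ℕ) : ℝ)) =
          ρ ^ (p.1 + p.2 + 2) / t ^ (α * ((p.1 + p.2 + 2 : ℕ) : ℝ)) := by
        rw [div_rpow (by positivity) ht.le, ← rpow_mul hρ0.le, ← mul_assoc,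
          one_div_mul_cancel hα.ne', one_mul, rpow_natCast]
      simp only [hd]
      rw [div_eq_mul_inv]
      calc |a| ^ p.1 * |b| ^ p.2 * (t ^ (α * ((p.1 + p.2 + 1 : ℕ) : ℝ) + α - 1) *
            (Gamma (α * ((p.1 + p.2 + 1 : ℕ) : ℝ) + α))⁻¹)
          ≤ |a| ^ p.1 * |b| ^ p.2 * (t ^ (α * ((p.1 + p.2 + 1 : ℕ) : ℝ) + α - 1) *
            (C * (ρ ^ (1 / α) / t) ^ (α * ((p.1 + p.2 + 1 : ℕ) : ℝ) + α))) := by gcongr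
        _ = _ := by
          rw [e, hq, rpow_sub ht, rpow_one]
          have : t ^ (α * ((p.1 + p.2 + 2 : ℕ) : ℝ)) ≠ 0 := by positivity
          field_simp
          ring
  have hsum' : Summable fun p : ℕ × ℕ => a ^ p.1 * b ^ p.2 * d (p.1 + p.2 + 1) := by
    refine Summable.of_norm (hsum.congr fun p => ?_)
    have h0 : 0 < d (p.1 + p.2 + 1) := div_pos (by positivity) (hΓ _)
    rw [norm_mul, norm_mul, norm_pow, norm_pow, norm_eq_abs, norm_eq_abs, norm_eq_abs,
      abs_of_pos h0]
  have hdsum : ∀ c : ℝ, Summable (fun n => c ^ n * d n) ∧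
      ∑' n, c ^ n * d n = t ^ (α - 1) * mittagLeffler α α (c * t ^ α) := by
    intro c
    have e : ∀ n : ℕ, t ^ (α - 1) * ((c * t ^ α) ^ n / Gamma (α * n + α)) = c ^ n * d n := by
      intro n; rw [key c n ht, hd]; ring
    refine ⟨((summable_mittagLeffler_s4 hα hα (c * t ^ α)).mul_left (t ^ (α - 1))).congr e, ?_⟩
    rw [mittagLeffler, ← tsum_mul_left]
    exact (tsum_congr e).symm
  have hswap : ∫ s in (0 : ℝ)..t, s ^ (α - 1) * (t - s) ^ (α - 1) *
        (mittagLeffler α α (a * s ^ α) * mittagLeffler α α (b * (t - s) ^ α)) =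
      ∑' p : ℕ × ℕ, a ^ p.1 * b ^ p.2 * d (p.1 + p.2 + 1) := by
    have h1 := hasSum_integral_of_summable_integral_norm (μ := volume.restrict (Ioc 0 t))
      (F := F) (fun p => (intervalIntegrable_iff_integrableOn_Ioc_of_le ht.le).1 (hFint p))
      (by simpa only [← integral_of_le ht.le, hFnorm] using hsum)
    simp only [← integral_of_le ht.le, hFval] at h1
    rw [h1.tsum_eq, integral_of_le ht.le, integral_of_le ht.le, integral_Ioc_eq_integral_Ioo,
      integral_Ioc_eq_integral_Ioo]
    refine setIntegral_congr_fun measurableSet_Ioo fun s hs => ?_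
    have hs' : 0 < t - s := by linarith [hs.2]
    have hA := ((summable_mittagLeffler_s4 hα hα (a * s ^ α)).mul_left (s ^ (α - 1)))
    have hB := ((summable_mittagLeffler_s4 hα hα (b * (t - s) ^ α)).mul_left ((t - s) ^ (α - 1)))
    have := tsum_mul_tsum_of_summable_norm hA.norm hB.norm
    rw [tsum_mul_left, tsum_mul_left] at this
    simp only [mittagLeffler]
    rw [mul_mul_mul_comm, this]
    refine tsum_congr fun p => ?_
    rw [key a _ hs.1, key b _ hs', hF]
    ring
  rw [hswap, sub_mul_tsum_pow_mul_pow hsum' (hdsum a).1 (hdsum b).1, (hdsum a).2, (hdsum b).2]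

lemma intervalIntegrable_resolvent {α : ℝ} (hα : 0 < α) (a b : ℝ) {t : ℝ} (ht : 0 < t) :
    IntervalIntegrable (fun s : ℝ => s ^ (α - 1) * (t - s) ^ (α - 1) *
      (mittagLeffler α α (a * s ^ α) * mittagLeffler α α (b * (t - s) ^ α))) volume 0 t := by
  refine (intervalIntegrable_rpow_mul_sub_rpow hα hα ht).mul_continuousOn ?_
  have hE := continuous_mittagLeffler hα hα
  have h1 : Continuous fun s : ℝ => s ^ α := continuous_id.rpow_const fun _ => Or.inr hα.le
  exact (((hE.comp (continuous_const.mul h1)).mul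
    (hE.comp (continuous_const.mul (h1.comp (continuous_const.sub continuous_id)))))).continuousOn

/-- Positivity propagates past the first candidate zero: a maximum principle for the Volterra
equation satisfied by `s ^ (α - 1) * E_{α,α}(-s ^ α)`. -/
lemma mittagLeffler_neg_rpow_pos_of_forall_lt {α : ℝ} (hα0 : 0 < α) (hα1 : α < 1) {T : ℝ}
    (hT : 0 < T) (hpos : ∀ s, 0 < s → s < T → 0 < mittagLeffler α α (-s ^ α)) :
    0 < mittagLeffler α α (-T ^ α) := by
  by_contra! hneg
  have hΓ : 0 < Gamma α := Gamma_pos_of_pos hα0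
  set y : ℝ → ℝ := fun s => s ^ (α - 1) * mittagLeffler α α (-s ^ α) with hy
  have hypos : ∀ s, 0 < s → s < T → 0 < y s := fun s h0 h1 =>
    mul_pos (rpow_pos_of_pos h0 _) (hpos s h0 h1)
  have hyT : y T ≤ 0 := mul_nonpos_of_nonneg_of_nonpos (rpow_nonneg hT.le _) hneg
  have hint : ∀ t, 0 < t →
      IntervalIntegrable (fun s => (t - s) ^ (α - 1) * y s) volume 0 t := by
    intro t ht
    refine ((intervalIntegrable_resolvent hα0 (-1) 0 ht).const_mul (Gamma α)).congr_ae
      (Eventually.of_forall fun s => ?_)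
    simp only [neg_mul, one_mul, zero_mul, mittagLeffler_zero, hy]
    field_simp
  have hvol : ∀ t, 0 < t →
      Gamma α * y t = t ^ (α - 1) - ∫ s in (0 : ℝ)..t, (t - s) ^ (α - 1) * y s := by
    intro t ht
    have h := resolvent_identity hα0 (-1) 0 ht
    have e : ∀ s : ℝ, s ^ (α - 1) * (t - s) ^ (α - 1) *
        (mittagLeffler α α (-s ^ α) * (1 / Gamma α)) =
          (1 / Gamma α) * ((t - s) ^ (α - 1) * y s) := by
      intro s; simp only [hy]; ring
    simp only [neg_mul, one_mul, zero_mul, mittagLeffler_zero, sub_zero, e,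
      intervalIntegral.integral_const_mul] at h
    have h' : y t = t ^ (α - 1) * (1 / Gamma α) -
        1 / Gamma α * ∫ s in (0 : ℝ)..t, (t - s) ^ (α - 1) * y s := by
      simp only [hy] at h ⊢
      linarith
    rw [h']
    field_simp
  set δ : ℝ := min (T / 2) ((α * Gamma α / 4) ^ (1 / α)) with hδ
  have hδ0 : 0 < δ := lt_min (by positivity) (by positivity)
  have hδT : δ ≤ T / 2 := min_le_left _ _
  have hδα : δ ^ α ≤ α * Gamma α / 4 := by
    calc δ ^ α ≤ ((α * Gamma α / 4) ^ (1 / α)) ^ α := by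
          gcongr
          exact min_le_right _ _
      _ = _ := by rw [← rpow_mul (by positivity), one_div_mul_cancel hα0.ne', rpow_one]
  have hycont : ContinuousOn y (Icc (T - δ) T) := by
    refine ContinuousOn.mul (continuousOn_id.rpow_const fun s hs => Or.inl ?_) ?_
    · have : T - δ ≤ s := hs.1
      simp only [id]
      linarith
    · exact ((continuous_mittagLeffler hα0 hα0).comp
        (continuous_id.rpow_const fun _ => Or.inr hα0.le).neg).continuousOn
  obtain ⟨τ, hτ, hmax⟩ := isCompact_Icc.exists_isMaxOn (nonempty_Icc.2 (by linarith)) hycont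
  have hM : 0 < y τ := (hypos (T - δ) (by linarith) (by linarith)).trans_le
    (hmax (left_mem_Icc.2 (by linarith)))
  have hτT : τ < T := by
    refine lt_of_le_of_ne hτ.2 ?_
    rintro rfl
    linarith
  have hτ2 : T / 2 ≤ τ := by linarith [hτ.1]
  have hτ0 : 0 < τ := by linarith
  set c : ℝ := (T / τ) ^ (α - 1) with hc
  have hc0 : 0 < c := by positivity
  have hc2 : 1 / 2 ≤ c := by
    calc (1 : ℝ) / 2 ≤ τ / T := by rw [div_le_div_iff₀ two_pos hT]; linarith
      _ = (T / τ) ^ (-1 : ℝ) := by rw [rpow_neg_one, inv_div]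
      _ ≤ c := rpow_le_rpow_of_exponent_le (by rw [le_div_iff₀ hτ0]; linarith) (by linarith)
  have hsub1 : IntervalIntegrable (fun s => (T - s) ^ (α - 1) * y s) volume 0 τ :=
    (hint T hT).mono_set (by
      rw [uIcc_of_le hτ0.le, uIcc_of_le hT.le]; exact Icc_subset_Icc_right hτT.le)
  have hsub2 : IntervalIntegrable (fun s => (T - s) ^ (α - 1) * y s) volume τ T :=
    (hint T hT).mono_set (by
      rw [uIcc_of_le hτT.le, uIcc_of_le hT.le]; exact Icc_subset_Icc_left hτ0.le)
  have hpast : ∫ s in (0 : ℝ)..τ, (T - s) ^ (α - 1) * y s ≤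
      c * ∫ s in (0 : ℝ)..τ, (τ - s) ^ (α - 1) * y s := by
    rw [← intervalIntegral.integral_const_mul]
    refine integral_mono_on_of_le_Ioo hτ0.le hsub1 ((hint τ hτ0).const_mul c) fun s hs => ?_
    have hτs : 0 < τ - s := by linarith [hs.2]
    rw [← mul_assoc c, hc, ← mul_rpow (by positivity) hτs.le]
    refine mul_le_mul_of_nonneg_right ?_ (hypos s hs.1 (hs.2.trans hτT)).le
    refine rpow_le_rpow_of_nonpos (by positivity) ?_ (by linarith)
    rw [div_mul_eq_mul_div, div_le_iff₀ hτ0]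
    nlinarith [hs.1]
  have hkint : IntervalIntegrable (fun s : ℝ => (T - s) ^ (α - 1)) volume τ T := by
    have := (intervalIntegrable_rpow' (a := T - τ) (b := T - T)
      (show -1 < α - 1 by linarith)).comp_sub_left T
    simpa using this
  have hkval : ∫ s in τ..T, (T - s) ^ (α - 1) = (T - τ) ^ α / α := by
    rw [integral_comp_sub_left (fun x : ℝ => x ^ (α - 1)) T, sub_self,
      integral_rpow (Or.inl (by linarith)), sub_add_cancel, zero_rpow hα0.ne', sub_zero]
  have hrecent : ∫ s in τ..T, (T - s) ^ (α - 1) * y s ≤ (T - τ) ^ α / α * y τ := by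
    rw [← hkval, ← intervalIntegral.integral_mul_const]
    refine integral_mono_on hτT.le hsub2 (hkint.mul_const _) fun s hs => ?_
    exact mul_le_mul_of_nonneg_left (hmax ⟨hτ.1.trans hs.1, hs.2⟩)
      (rpow_nonneg (by linarith [hs.2]) _)
  have hTτ : (T - τ) ^ α / α ≤ Gamma α / 4 := by
    rw [div_le_iff₀ hα0]
    calc (T - τ) ^ α ≤ δ ^ α := by
          have : 0 ≤ T - τ := by linarith
          have : T - τ ≤ δ := by linarith [hτ.1]
          gcongr
      _ ≤ _ := by linarith
  have hTpow : T ^ (α - 1) = c * τ ^ (α - 1) := by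
    rw [hc, ← mul_rpow (by positivity) hτ0.le, div_mul_cancel₀ _ hτ0.ne']
  have h1 := hvol T hT
  have h2 := hvol τ hτ0
  rw [← integral_add_adjacent_intervals hsub1 hsub2, hTpow] at h1
  have h3 : c * (Gamma α * y τ) = c * τ ^ (α - 1) -
      c * ∫ s in (0 : ℝ)..τ, (τ - s) ^ (α - 1) * y s := by rw [h2]; ring
  have h4 : 1 / 2 * (Gamma α * y τ) ≤ c * (Gamma α * y τ) := by gcongr
  have h5 : (T - τ) ^ α / α * y τ ≤ Gamma α / 4 * y τ := by gcongr
  have h6 : Gamma α * y T ≤ 0 := mul_nonpos_of_nonneg_of_nonpos hΓ.le hyT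
  have h7 : 0 < Gamma α * y τ := by positivity
  linarith

lemma mittagLeffler_neg_pos {α : ℝ} (hα0 : 0 < α) (hα1 : α < 1) {x : ℝ} (hx : 0 ≤ x) :
    0 < mittagLeffler α α (-x) := by
  by_contra! hneg
  set g : ℝ → ℝ := fun t => mittagLeffler α α (-t ^ α) with hg
  have hgc : Continuous g := (continuous_mittagLeffler hα0 hα0).comp
    (continuous_id.rpow_const fun _ => Or.inr hα0.le).neg
  set X : ℝ := x ^ (1 / α) with hX
  have hX0 : 0 ≤ X := rpow_nonneg hx _
  have hgX : g X ≤ 0 := by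
    simp only [hg, hX]
    rwa [← rpow_mul hx, one_div_mul_cancel hα0.ne', rpow_one]
  have hcomp : IsCompact (Icc 0 X ∩ g ⁻¹' Iic 0) :=
    isCompact_Icc.inter_right (isClosed_Iic.preimage hgc)
  obtain ⟨T, ⟨hTX, hTg⟩, hTmin⟩ := hcomp.exists_isLeast ⟨X, right_mem_Icc.2 hX0, hgX⟩
  have hg0 : 0 < g 0 := by
    simp only [hg, zero_rpow hα0.ne', neg_zero, mittagLeffler_zero]
    exact one_div_pos.2 (Gamma_pos_of_pos hα0)
  have hT0 : 0 < T := by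
    refine lt_of_le_of_ne hTX.1 ?_
    rintro rfl
    exact absurd hTg (not_le.2 hg0)
  have := mittagLeffler_neg_rpow_pos_of_forall_lt hα0 hα1 hT0 fun s hs hsT => by
    by_contra! h
    exact absurd (hTmin ⟨⟨hs.le, hsT.le.trans hTX.2⟩, h⟩) (not_le.2 hsT)
  exact absurd hTg (not_le.2 this)

lemma antitoneOn_mittagLeffler_neg {α : ℝ} (hα0 : 0 < α) (hα1 : α < 1) :
    AntitoneOn (fun η : ℝ => mittagLeffler α α (-η)) (Ici 0) := by
  intro x hx z hz hxz
  have hx' : (0 : ℝ) ≤ x := hx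
  have hz' : (0 : ℝ) ≤ z := hz
  have h := resolvent_identity hα0 (-x) (-z) one_pos
  have hI : 0 ≤ ∫ s in (0 : ℝ)..1, s ^ (α - 1) * (1 - s) ^ (α - 1) *
      (mittagLeffler α α (-x * s ^ α) * mittagLeffler α α (-z * (1 - s) ^ α)) := by
    refine integral_nonneg zero_le_one fun s hs => ?_
    have h0 : 0 ≤ s := hs.1
    have h1 : 0 ≤ 1 - s := by linarith [hs.2]
    rw [neg_mul, neg_mul]
    have := mittagLeffler_neg_pos hα0 hα1 (show 0 ≤ x * s ^ α by positivity)
    have := mittagLeffler_neg_pos hα0 hα1 (show 0 ≤ z * (1 - s) ^ α by positivity)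
    positivity
  simp only [one_rpow, mul_one, one_mul] at h
  have := mul_nonneg (show 0 ≤ -x - -z by linarith) hI
  simp only
  linarith

/-- For `0 < α < 1` and `η > 0`, one has `0 ≤ E_{α,α}(−η) ≤ 1/Γ(α)`; moreover
`η ↦ E_{α,α}(−η)` is monotonically decreasing on `(0,∞)`. -/
theorem mittagLeffler_alpha_alpha_bounds (α : ℝ) (hα0 : 0 < α) (hα1 : α < 1) :
    (∀ η : ℝ, 0 < η →
      0 ≤ mittagLeffler α α (-η) ∧ mittagLeffler α α (-η) ≤ 1 / Real.Gamma α) ∧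
    AntitoneOn (fun η : ℝ => mittagLeffler α α (-η)) (Set.Ioi 0) := by
  have hanti := antitoneOn_mittagLeffler_neg hα0 hα1
  refine ⟨fun η hη => ⟨(mittagLeffler_neg_pos hα0 hα1 hη.le).le, ?_⟩,
    hanti.mono Set.Ioi_subset_Ici_self⟩
  have h := hanti Set.self_mem_Ici (Set.mem_Ici.2 hη.le) hη.le
  simpa only [neg_zero, mittagLeffler_zero] using h
end
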